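/- Let k be a field of characteristic p > 0, let G be a finite group whose order is divisible by p, let M be a finite-dimensional kG-module, and let K be an algebraic closure of k. Then the following are equivalent: (1) the unit η_M: k → M^∨ ⊗ M is a split monomorphism of kG-modules; (2) the trace map tr: M^∨ ⊗ M → k is a split epimorphism of kG-modules; (3) the trivial kG-module k is a direct summand of M^∨ ⊗ M; (4) there exists a finite-dimensional kG-module X such that k is a direct summand of X ⊗ M; (5) some indecomposable direct summand of the KG-module K ⊗_k M has K-dimension not divisible by p. -/

import Mathlib

open TensorProduct

section Defs

variable {k G : Type} [Field k] [Group G]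

/-- A `kG`-linear map between two representations of `G` over `k`:
a `k`-linear map commuting with the `G`-actions. -/
def Equivariant {V W : Type} [AddCommGroup V] [Module k V] [AddCommGroup W] [Module k W]
    (ρV : Representation k G V) (ρW : Representation k G W) (f : V →ₗ[k] W) : Prop :=
  ∀ g : G, f ∘ₗ ρV g = ρW g ∘ₗ f

/-- `ρU` is (isomorphic to) a direct summand of `ρM`, witnessed by an equivariant
split monomorphism. -/
def IsDirectSummandRep {U M : Type} [AddCommGroup U] [Module k U]
    [AddCommGroup M] [Module k M]
    (ρU : Representation k G U) (ρM : Representation k G M) : Prop :=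
  ∃ (i : U →ₗ[k] M) (r : M →ₗ[k] U),
    Equivariant ρU ρM i ∧ Equivariant ρM ρU r ∧ r ∘ₗ i = LinearMap.id

/-- A submodule is a subrepresentation if it is stable under the `G`-action. -/
def IsSubrep {V : Type} [AddCommGroup V] [Module k V] (ρ : Representation k G V)
    (p : Submodule k V) : Prop := ∀ g : G, ∀ x ∈ p, ρ g x ∈ p

/-- A representation is indecomposable if it is nonzero and not the direct sum of
two nonzero subrepresentations. -/
def IndecomposableRep {V : Type} [AddCommGroup V] [Module k V]
    (ρ : Representation k G V) : Prop :=
  Nontrivial V ∧ ¬ ∃ p q : Submodule k V,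
    IsSubrep ρ p ∧ IsSubrep ρ q ∧ IsCompl p q ∧ p ≠ ⊥ ∧ q ≠ ⊥

/-- The base change (extension of scalars) of a representation along a field
extension `k → K`. -/
noncomputable def bcRep (K : Type) [Field K] [Algebra k K] {V : Type} [AddCommGroup V]
    [Module k V] (ρ : Representation k G V) : Representation K G (K ⊗[k] V) :=
  (Module.End.baseChangeHom k K V).toRingHom.toMonoidHom.comp ρ

end Defs

/-- The unit `η : k → M∨ ⊗ M`, sending `1` to the tensor corresponding to the
identity of `M` under `M∨ ⊗ M ≅ End_k(M)`. -/
noncomputable def unitMap (k : Type) (V : Type) [Field k] [AddCommGroup V] [Module k V]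
    [FiniteDimensional k V] : k →ₗ[k] Module.Dual k V ⊗[k] V :=
  LinearMap.toSpanSingleton k _ ((dualTensorHomEquiv k V V).symm LinearMap.id)

section TraceCriterion

variable {k G : Type} [Field k] [Group G]

namespace Equivariant

variable {U V W : Type} [AddCommGroup U] [Module k U] [AddCommGroup V] [Module k V]
  [AddCommGroup W] [Module k W] {ρU : Representation k G U} {ρV : Representation k G V}
  {ρW : Representation k G W}

theorem apply {f : V →ₗ[k] W} (hf : Equivariant ρV ρW f) (g : G) (x : V) :
    f (ρV g x) = ρW g (f x) :=
  LinearMap.congr_fun (hf g) x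

theorem comp {f : V →ₗ[k] W} {h : U →ₗ[k] V} (hf : Equivariant ρV ρW f)
    (hh : Equivariant ρU ρV h) : Equivariant ρU ρW (f ∘ₗ h) := fun g ↦ by
  rw [LinearMap.comp_assoc, hh g, ← LinearMap.comp_assoc, hf g, LinearMap.comp_assoc]

theorem isSubrep_ker {f : V →ₗ[k] W} (hf : Equivariant ρV ρW f) :
    IsSubrep ρV (LinearMap.ker f) := fun g x hx ↦ by
  rw [LinearMap.mem_ker] at hx ⊢
  rw [hf.apply, hx, map_zero]

theorem isSubrep_range {f : V →ₗ[k] W} (hf : Equivariant ρV ρW f) :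
    IsSubrep ρW (LinearMap.range f) := by
  rintro g _ ⟨y, rfl⟩
  exact ⟨ρV g y, hf.apply g y⟩

theorem pow {f : V →ₗ[k] V} (hf : Equivariant ρV ρV f) (n : ℕ) :
    Equivariant ρV ρV (f ^ n) := fun g ↦
  ((show Commute f (ρV g) from hf g).pow_left n).eq

theorem sub_algebraMap {f : V →ₗ[k] V} (hf : Equivariant ρV ρV f) (μ : k) :
    Equivariant ρV ρV (f - algebraMap k (Module.End k V) μ) := fun g ↦
  ((show Commute f (ρV g) from hf g).sub_left (Algebra.commutes μ (ρV g))).eq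

/-- The endomorphism attached to an invariant of `V∨ ⊗ V` is equivariant. -/
theorem dualTensorHom_of_invariant {t : Module.Dual k V ⊗[k] V}
    (ht : ∀ g, (ρV.dual.tprod ρV) g t = t) : Equivariant ρV ρV (dualTensorHom k V V t) :=
  fun g ↦ by
    have h := LinearMap.congr_fun (Representation.dualTensorHom_comm ρV ρV g) t
    simp only [LinearMap.comp_apply, ← Representation.tprod_apply, ht,
      Representation.linHom_apply] at h
    ext x
    have hx := LinearMap.congr_fun h (ρV g x)
    simpa using hx

end Equivariant

theorem IsDirectSummandRep.trans {U V W : Type} [AddCommGroup U] [Module k U] [AddCommGroup V]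
    [Module k V] [AddCommGroup W] [Module k W] {ρU : Representation k G U}
    {ρV : Representation k G V} {ρW : Representation k G W}
    (h₁ : IsDirectSummandRep ρU ρV) (h₂ : IsDirectSummandRep ρV ρW) :
    IsDirectSummandRep ρU ρW := by
  obtain ⟨i, r, hi, hr, hri⟩ := h₁
  obtain ⟨j, s, hj, hs, hsj⟩ := h₂
  refine ⟨j ∘ₗ i, r ∘ₗ s, hj.comp hi, hr.comp hs, ?_⟩
  rw [LinearMap.comp_assoc, ← LinearMap.comp_assoc i, hsj, LinearMap.id_comp, hri]

section Summand

variable {V : Type} [AddCommGroup V] [Module k V] {ρ : Representation k G V}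

theorem equivariant_subtype {P : Submodule k V} (hP : IsSubrep ρ P) :
    Equivariant (ρ.subrepresentation P hP) ρ P.subtype := fun _ ↦ rfl

theorem equivariant_projectionOnto {P Q : Submodule k V} (hP : IsSubrep ρ P)
    (hQ : IsSubrep ρ Q) (h : IsCompl P Q) :
    Equivariant ρ (ρ.subrepresentation P hP) (P.projectionOnto Q h) := fun g ↦ by
  ext x
  obtain ⟨y, hy, z, hz, rfl⟩ := Submodule.mem_sup.mp (h.sup_eq_top ▸ Submodule.mem_top (x := x))
  have e₁ := Submodule.projectionOnto_apply_left h ⟨y, hy⟩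
  have e₂ := Submodule.projectionOnto_apply_left h ⟨ρ g y, hP g y hy⟩
  have e₃ := Submodule.projectionOnto_apply_of_mem_right h hz
  have e₄ := Submodule.projectionOnto_apply_of_mem_right h (hQ g z hz)
  simp only at e₁ e₂
  simp only [LinearMap.comp_apply, map_add, e₁, e₂, e₃, e₄, map_zero, add_zero]
  rfl

theorem isDirectSummandRep_subrepresentation {P Q : Submodule k V} (hP : IsSubrep ρ P)
    (hQ : IsSubrep ρ Q) (h : IsCompl P Q) :
    IsDirectSummandRep (ρ.subrepresentation P hP) ρ :=
  ⟨P.subtype, P.projectionOnto Q h, equivariant_subtype hP, equivariant_projectionOnto hP hQ h,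
    Submodule.projectionOnto_comp_subtype h⟩

theorem trace_eq_add_of_isCompl [FiniteDimensional k V] {P Q : Submodule k V} (h : IsCompl P Q)
    (f : V →ₗ[k] V) :
    LinearMap.trace k V f =
      LinearMap.trace k P (P.projectionOnto Q h ∘ₗ f ∘ₗ P.subtype) +
        LinearMap.trace k Q (Q.projectionOnto P h.symm ∘ₗ f ∘ₗ Q.subtype) := by
  rw [LinearMap.trace_comp_comm', LinearMap.trace_comp_comm' (f ∘ₗ Q.subtype), ← map_add,
    LinearMap.comp_assoc, LinearMap.comp_assoc, ← LinearMap.comp_add]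
  congr 1
  ext x
  have := Submodule.projection_add_projection_eq_self h x
  simp [this]

end Summand

/-- Over an algebraically closed field, an equivariant endomorphism of an indecomposable
representation has a single eigenvalue, so its trace is a multiple of the dimension. -/
theorem IndecomposableRep.exists_trace_eq [IsAlgClosed k] {V : Type} [AddCommGroup V]
    [Module k V] [FiniteDimensional k V] {ρ : Representation k G V} (hρ : IndecomposableRep ρ)
    {f : V →ₗ[k] V} (hf : Equivariant ρ ρ f) :
    ∃ μ : k, LinearMap.trace k V f = μ * Module.finrank k V := by
  obtain ⟨hnt, hind⟩ := hρ
  obtain ⟨μ, hμ⟩ := Module.End.exists_eigenvalue f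
  obtain ⟨v, hv⟩ := hμ.exists_hasEigenvector
  set d : Module.End k V := f - algebraMap k (Module.End k V) μ with hd
  obtain ⟨n, hn, hn₁⟩ := (d.eventually_isCompl_ker_pow_range_pow.and
    (Filter.eventually_ge_atTop 1)).exists
  have hdn : Equivariant ρ ρ (d ^ n) := (hf.sub_algebraMap μ).pow n
  have hdv : d v = 0 := by simp [hd, hv.apply_eq_smul]
  have hker : LinearMap.ker (d ^ n) ≠ ⊥ := by
    refine (Submodule.ne_bot_iff _).mpr ⟨v, ?_, hv.2⟩
    obtain ⟨m, rfl⟩ := Nat.exists_eq_add_of_le' hn₁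
    rw [LinearMap.mem_ker, pow_succ, Module.End.mul_apply, hdv, map_zero]
  have hrange : LinearMap.range (d ^ n) = ⊥ := by
    by_contra hne
    exact hind ⟨_, _, hdn.isSubrep_ker, hdn.isSubrep_range, hn, hker, hne⟩
  have hnil : IsNilpotent d := ⟨n, LinearMap.range_eq_bot.mp hrange⟩
  refine ⟨μ, ?_⟩
  have := LinearMap.trace_comp_eq_mul_of_commute_of_isNilpotent (f := 1) (g := f) μ
    (Commute.one_left f) hnil
  rwa [LinearMap.trace_one] at this

/-- Over an algebraically closed field, a representation with an equivariant endomorphism of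
nonzero trace has an indecomposable summand whose dimension is nonzero in the field. -/
theorem exists_indecomposable_summand_of_trace_ne_zero [IsAlgClosed k] {V : Type}
    [AddCommGroup V] [Module k V] [FiniteDimensional k V] {ρ : Representation k G V}
    {f : V →ₗ[k] V} (hf : Equivariant ρ ρ f) (htr : LinearMap.trace k V f ≠ 0) :
    ∃ (U : Type) (_ : AddCommGroup U) (_ : Module k U) (ρU : Representation k G U),
      IndecomposableRep ρU ∧ IsDirectSummandRep ρU ρ ∧ (Module.finrank k U : k) ≠ 0 := by
  induction hN : Module.finrank k V using Nat.strong_induction_on generalizing V with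
  | _ N ih =>
  subst hN
  by_cases hind : IndecomposableRep ρ
  · obtain ⟨μ, hμ⟩ := hind.exists_trace_eq hf
    exact ⟨V, _, _, ρ, hind, ⟨.id, .id, fun _ ↦ rfl, fun _ ↦ rfl, rfl⟩,
      right_ne_zero_of_mul (hμ ▸ htr)⟩
  have hnt : Nontrivial V := by
    by_contra h
    rw [not_nontrivial_iff_subsingleton] at h
    exact htr (by rw [Subsingleton.elim f 0, map_zero])
  obtain ⟨P, Q, hP, hQ, hPQ, hP₀, hQ₀⟩ := not_not.mp (not_and.mp hind hnt)
  have descend : ∀ {P Q : Submodule k V} (hP : IsSubrep ρ P) (hQ : IsSubrep ρ Q)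
      (h : IsCompl P Q), Q ≠ ⊥ →
      LinearMap.trace k P (P.projectionOnto Q h ∘ₗ f ∘ₗ P.subtype) ≠ 0 →
      ∃ (U : Type) (_ : AddCommGroup U) (_ : Module k U) (ρU : Representation k G U),
        IndecomposableRep ρU ∧ IsDirectSummandRep ρU ρ ∧ (Module.finrank k U : k) ≠ 0 := by
    intro P Q hP hQ h hQ₀ ht
    have hlt : Module.finrank k P < Module.finrank k V :=
      Submodule.finrank_lt fun hP ↦ hQ₀ (by simpa [hP] using h.inf_eq_bot)
    obtain ⟨U, _, _, ρU, hU, hs, hdim⟩ := ih _ hlt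
      ((equivariant_projectionOnto hP hQ h).comp (hf.comp (equivariant_subtype hP))) ht rfl
    exact ⟨U, _, _, ρU, hU, hs.trans (isDirectSummandRep_subrepresentation hP hQ h), hdim⟩
  rw [trace_eq_add_of_isCompl hPQ] at htr
  by_cases h₀ : LinearMap.trace k P (P.projectionOnto Q hPQ ∘ₗ f ∘ₗ P.subtype) = 0
  · rw [h₀, zero_add] at htr
    exact descend hQ hP hPQ.symm hP₀ htr
  · exact descend hP hQ hPQ hQ₀ h₀

/-- The idempotent of a direct summand has the dimension of the summand as its trace. -/
theorem IsDirectSummandRep.exists_trace_eq_finrank {U V : Type} [AddCommGroup U] [Module k U]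
    [AddCommGroup V] [Module k V] [FiniteDimensional k V] {ρU : Representation k G U}
    {ρV : Representation k G V} (h : IsDirectSummandRep ρU ρV) :
    ∃ f : V →ₗ[k] V, Equivariant ρV ρV f ∧ LinearMap.trace k V f = Module.finrank k U := by
  obtain ⟨i, r, hi, hr, hri⟩ := h
  have : FiniteDimensional k U := Module.Finite.of_surjective r
    (Function.LeftInverse.surjective (LinearMap.congr_fun hri))
  exact ⟨i ∘ₗ r, hi.comp hr, by rw [LinearMap.trace_comp_comm', hri, LinearMap.trace_id]⟩

section BaseChange

variable (K : Type) [Field K] [Algebra k K] {V : Type} [AddCommGroup V] [Module k V]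

/-- The `k`-linear endomorphism of `V` obtained from a `K`-linear endomorphism of `K ⊗ V` by
applying a `k`-linear functional on `K` to the coefficients. -/
noncomputable def descendEnd (l : K →ₗ[k] k) (f : K ⊗[k] V →ₗ[K] K ⊗[k] V) : V →ₗ[k] V :=
  TensorProduct.lid k V ∘ₗ l.rTensor V ∘ₗ f.restrictScalars k ∘ₗ TensorProduct.mk k K V 1

variable {K}

theorem descendEnd_apply (l : K →ₗ[k] k) (f : K ⊗[k] V →ₗ[K] K ⊗[k] V) (x : V) :
    descendEnd K l f x = TensorProduct.lid k V (l.rTensor V (f (1 ⊗ₜ x))) := rfl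

theorem trace_descendEnd [FiniteDimensional k V] (l : K →ₗ[k] k)
    (f : K ⊗[k] V →ₗ[K] K ⊗[k] V) :
    LinearMap.trace k V (descendEnd K l f) = l (LinearMap.trace K (K ⊗[k] V) f) := by
  classical
  let b := Module.finBasis k V
  have hrepr : ∀ (y : K ⊗[k] V) (j),
      b.repr (TensorProduct.lid k V (l.rTensor V y)) j = l ((b.baseChange K).repr y j) := by
    intro y j
    induction y using TensorProduct.induction_on with
    | zero => simp
    | tmul a x => simp [mul_comm]
    | add y z hy hz => simp [hy, hz]
  rw [LinearMap.trace_eq_matrix_trace k b, LinearMap.trace_eq_matrix_trace K (b.baseChange K),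
    Matrix.trace, Matrix.trace, map_sum]
  refine Finset.sum_congr rfl fun j _ ↦ ?_
  simp [Matrix.diag, LinearMap.toMatrix_apply, descendEnd_apply, hrepr]

theorem bcRep_apply (ρ : Representation k G V) (g : G) :
    bcRep K ρ g = (ρ g).baseChange K := rfl

theorem Equivariant.descendEnd {ρ : Representation k G V} {f : K ⊗[k] V →ₗ[K] K ⊗[k] V}
    (hf : Equivariant (bcRep K ρ) (bcRep K ρ) f) (l : K →ₗ[k] k) :
    Equivariant ρ ρ (descendEnd K l f) := fun g ↦ by
  have key : ∀ y : K ⊗[k] V, TensorProduct.lid k V (l.rTensor V ((ρ g).baseChange K y)) =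
      ρ g (TensorProduct.lid k V (l.rTensor V y)) := by
    intro y
    induction y using TensorProduct.induction_on with
    | zero => simp
    | tmul a x => simp
    | add y z hy hz => simp only [map_add, hy, hz]
  ext x
  have h := hf.apply g (1 ⊗ₜ x)
  rw [bcRep_apply, LinearMap.baseChange_tmul] at h
  simp only [LinearMap.comp_apply, descendEnd_apply, h, key]

theorem Equivariant.baseChange {ρ : Representation k G V} {f : V →ₗ[k] V}
    (hf : Equivariant ρ ρ f) : Equivariant (bcRep K ρ) (bcRep K ρ) (f.baseChange K) :=
  fun g ↦ by
    rw [bcRep_apply, ← LinearMap.baseChange_comp, hf g, LinearMap.baseChange_comp]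

/-- Having an equivariant endomorphism of nonzero trace is invariant under field extension. -/
theorem exists_equivariant_trace_ne_zero_bcRep_iff [FiniteDimensional k V]
    {ρ : Representation k G V} :
    (∃ f : K ⊗[k] V →ₗ[K] K ⊗[k] V, Equivariant (bcRep K ρ) (bcRep K ρ) f ∧
      LinearMap.trace K (K ⊗[k] V) f ≠ 0) ↔
    ∃ f : V →ₗ[k] V, Equivariant ρ ρ f ∧ LinearMap.trace k V f ≠ 0 := by
  constructor
  · rintro ⟨f, hf, htr⟩
    obtain ⟨l, hl⟩ := Module.Projective.exists_dual_ne_zero k htr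
    exact ⟨_, hf.descendEnd l, by rwa [trace_descendEnd]⟩
  · rintro ⟨f, hf, htr⟩
    refine ⟨_, hf.baseChange, ?_⟩
    rw [LinearMap.trace_baseChange]
    exact (map_ne_zero _).mpr htr

end BaseChange

section Invariants

variable {V : Type} [AddCommGroup V] [Module k V] {ρ : Representation k G V}

theorem equivariant_trivial_toSpanSingleton {t : V} (ht : ∀ g, ρ g t = t) :
    Equivariant (Representation.trivial k (G := G) (V := k)) ρ
      (LinearMap.toSpanSingleton k V t) := fun g ↦ by
  ext
  simp [ht]

/-- The tensor attached to an equivariant endomorphism is invariant. -/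
theorem Equivariant.tprod_dualTensorHomEquiv_symm [FiniteDimensional k V] {f : V →ₗ[k] V}
    (hf : Equivariant ρ ρ f) (g : G) :
    (ρ.dual.tprod ρ) g ((dualTensorHomEquiv k V V).symm f) =
      (dualTensorHomEquiv k V V).symm f := by
  apply (dualTensorHomEquiv k V V).injective
  have h := LinearMap.congr_fun (Representation.dualTensorHom_comm ρ ρ g)
    ((dualTensorHomEquiv k V V).symm f)
  have e : dualTensorHom k V V ((dualTensorHomEquiv k V V).symm f) = f :=
    (dualTensorHomEquiv k V V).apply_symm_apply f
  rw [LinearEquiv.apply_symm_apply]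
  simp only [LinearMap.comp_apply, e, Representation.linHom_apply] at h
  refine h.trans ?_
  rw [← LinearMap.comp_assoc, ← hf g, LinearMap.comp_assoc]
  ext x
  simp

/-- Pairing an equivariant endomorphism with `V∨ ⊗ V ≅ End V` by the trace form is equivariant. -/
theorem Equivariant.trace_mulLeft {f : V →ₗ[k] V} (hf : Equivariant ρ ρ f) :
    Equivariant (V := Module.Dual k V ⊗[k] V) (ρ.dual.tprod ρ)
      (Representation.trivial k (G := G) (V := k))
      (LinearMap.trace k V ∘ₗ LinearMap.mulLeft k f ∘ₗ dualTensorHom k V V) := fun g ↦ by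
  refine LinearMap.ext fun t ↦ ?_
  have h := LinearMap.congr_fun (Representation.dualTensorHom_comm ρ ρ g) t
  simp only [LinearMap.comp_apply, ← Representation.tprod_apply,
    Representation.linHom_apply] at h
  simp only [LinearMap.comp_apply, LinearMap.mulLeft_apply, h, Representation.trivial_apply,
    ← Module.End.mul_eq_comp]
  have hfg : f * ρ g = ρ g * f := hf g
  rw [← mul_assoc, hfg, mul_assoc, LinearMap.trace_mul_comm, mul_assoc, mul_assoc, ← map_mul,
    inv_mul_cancel, map_one, mul_one]

/-- The trivial module is a summand of `X ⊗ V` only if some invariant of `V∨ ⊗ V` has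
contraction `1`. -/
theorem exists_contractLeft_section_of_summand_tprod {X : Type} [AddCommGroup X] [Module k X]
    {ρX : Representation k G X}
    (h : IsDirectSummandRep (Representation.trivial k (G := G) (V := k)) (ρX.tprod ρ)) :
    ∃ s : k →ₗ[k] Module.Dual k V ⊗[k] V,
      Equivariant (W := Module.Dual k V ⊗[k] V)
        (Representation.trivial k (G := G) (V := k)) (ρ.dual.tprod ρ) s ∧
      contractLeft k V ∘ₗ s = LinearMap.id := by
  obtain ⟨i, r, hi, hr, hri⟩ := h
  let c : X ⊗[k] V →ₗ[k] Module.Dual k V ⊗[k] V := (TensorProduct.curry r).rTensor V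
  have hc : Equivariant (V := X ⊗[k] V) (W := Module.Dual k V ⊗[k] V) (ρX.tprod ρ)
      (ρ.dual.tprod ρ) c := fun g ↦ by
    refine TensorProduct.ext' fun x v ↦ ?_
    simp only [c, LinearMap.comp_apply, Representation.tprod_apply, TensorProduct.map_tmul,
      LinearMap.rTensor_tmul]
    congr 1
    ext w
    have := hr.apply g (x ⊗ₜ ρ g⁻¹ w)
    simpa [Module.Dual.transpose_apply] using this
  refine ⟨c ∘ₗ i, hc.comp hi, ?_⟩
  have : contractLeft k V ∘ₗ c = r := by
    refine TensorProduct.ext' fun x v ↦ ?_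
    simp [c]
  rw [← LinearMap.comp_assoc, this, hri]

end Invariants

end TraceCriterion

/-- Characterizations of `⊗`-faithfulness of a finite-dimensional `kG`-module `M`:
the unit `η : k → M∨ ⊗ M` splits, iff the trace `M∨ ⊗ M → k` splits, iff `k` is a
direct summand of `M∨ ⊗ M`, iff `k` is a direct summand of some `X ⊗ M`, iff some
indecomposable direct summand of `K ⊗ₖ M` has dimension prime to `p`. -/
theorem tensor_faithful_tfae
    (p : ℕ) (hp : p.Prime) (k : Type) [Field k] [CharP k p]
    (G : Type) [Group G] [Fintype G] (hG : p ∣ Fintype.card G)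
    (K : Type) [Field K] [Algebra k K] [IsAlgClosure k K]
    (M : Type) [AddCommGroup M] [Module k M] [FiniteDimensional k M]
    (ρ : Representation k G M) :
    List.TFAE
      [ ∃ r : Module.Dual k M ⊗[k] M →ₗ[k] k,
          Equivariant (V := Module.Dual k M ⊗[k] M)
            (ρ.dual.tprod ρ) (Representation.trivial k (G := G) (V := k)) r ∧
          r ∘ₗ unitMap k M = LinearMap.id,
        ∃ s : k →ₗ[k] Module.Dual k M ⊗[k] M,
          Equivariant (W := Module.Dual k M ⊗[k] M)
            (Representation.trivial k (G := G) (V := k)) (ρ.dual.tprod ρ) s ∧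
          contractLeft k M ∘ₗ s = LinearMap.id,
        IsDirectSummandRep (M := Module.Dual k M ⊗[k] M)
          (Representation.trivial k (G := G) (V := k)) (ρ.dual.tprod ρ),
        ∃ (X : Type) (_ : AddCommGroup X) (_ : Module k X) (_ : FiniteDimensional k X)
          (ρX : Representation k G X),
          IsDirectSummandRep (Representation.trivial k (G := G) (V := k)) (ρX.tprod ρ),
        ∃ (U : Type) (_ : AddCommGroup U) (_ : Module K U) (ρU : Representation K G U),
          IndecomposableRep ρU ∧ IsDirectSummandRep ρU (bcRep K ρ) ∧
          ¬ (p ∣ Module.finrank K U) ] := by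
  have hchar : CharP K p := charP_of_injective_algebraMap (algebraMap k K).injective p
  have : IsAlgClosed K := IsAlgClosure.isAlgClosed k
  tfae_have 1 → 3 := fun ⟨r, hr, hri⟩ ↦
    ⟨unitMap k M, r, equivariant_trivial_toSpanSingleton
      (Equivariant.tprod_dualTensorHomEquiv_symm (f := LinearMap.id) fun _ ↦ rfl), hr, hri⟩
  tfae_have 3 → 4 := fun h ↦ ⟨Module.Dual k M, _, _, inferInstance, ρ.dual, h⟩
  tfae_have 4 → 2 := fun ⟨_, _, _, _, _, h⟩ ↦ exists_contractLeft_section_of_summand_tprod h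
  tfae_have 2 → 5 := by
    rintro ⟨s, hs, hcs⟩
    have htr : LinearMap.trace k M (dualTensorHom k M M (s 1)) ≠ 0 := by
      rw [LinearMap.trace_eq_contract_apply]
      exact ne_of_eq_of_ne (LinearMap.congr_fun hcs 1) one_ne_zero
    obtain ⟨f, hf, htr⟩ := exists_equivariant_trace_ne_zero_bcRep_iff (K := K).mpr
      ⟨_, Equivariant.dualTensorHom_of_invariant (ρV := ρ) fun g ↦ (hs.apply g 1).symm, htr⟩
    obtain ⟨U, _, _, ρU, hU, hs, hdim⟩ := exists_indecomposable_summand_of_trace_ne_zero hf htr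
    exact ⟨U, _, _, ρU, hU, hs, fun h ↦ hdim ((CharP.cast_eq_zero_iff K p _).mpr h)⟩
  tfae_have 5 → 1 := by
    rintro ⟨U, _, _, ρU, -, hs, hdim⟩
    obtain ⟨e, he, htr⟩ := hs.exists_trace_eq_finrank
    obtain ⟨f, hf, htr⟩ := exists_equivariant_trace_ne_zero_bcRep_iff (K := K).mp
      ⟨e, he, by rwa [htr, Ne, CharP.cast_eq_zero_iff K p]⟩
    refine ⟨(LinearMap.trace k M f)⁻¹ •
      (LinearMap.trace k M ∘ₗ LinearMap.mulLeft k f ∘ₗ dualTensorHom k M M), fun g ↦ ?_, ?_⟩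
    · rw [LinearMap.smul_comp, hf.trace_mulLeft g, LinearMap.comp_smul]
    · ext
      simp [unitMap, ← Module.End.one_eq_id, htr]
  tfae_finish
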